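/- Let R be an associative ring with unit. The following are equivalent: (a) Findim(R) < ∞; (b) there exists a hereditary complete cotorsion pair (A, B) in Mod R with pd_A(A) < ∞ and resdim_A(P) < ∞; (c) every hereditary complete cotorsion pair (A, B) in Mod R with pd_A(A) < ∞ satisfies resdim_A(P) < ∞. -/

import Mathlib

noncomputable section

open CategoryTheory CategoryTheory.Limits Opposite DirectSum

universe u

namespace CotorsionDim

variable {R : Type u} [Ring R]

/-- `Ext^n_R(M,N) = 0`. -/
def ExtZero (M N : ModuleCat.{u} R) (n : ℕ) : Prop :=
  IsZero (((Ext ℤ (ModuleCat.{u} R) n).obj (op M)).obj N)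

/-- A pair of composable maps forms a short exact sequence `0 → A → B → C → 0`. -/
def IsSES {A B C : ModuleCat.{u} R} (f : A ⟶ B) (g : B ⟶ C) : Prop :=
  ∃ w : f ≫ g = 0, (CategoryTheory.ShortComplex.mk f g w).ShortExact

/-- relative projective dimension `pd_𝒳(M)` -/
def rpd (𝒳 : Set (ModuleCat.{u} R)) (M : ModuleCat.{u} R) : ℕ∞ :=
  sInf {n : ℕ∞ | ∀ j : ℕ, n < (j : ℕ∞) → ∀ X ∈ 𝒳, ExtZero M X j}

/-- relative injective dimension `id_𝒳(M)` -/
def rid (𝒳 : Set (ModuleCat.{u} R)) (M : ModuleCat.{u} R) : ℕ∞ :=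
  sInf {n : ℕ∞ | ∀ j : ℕ, n < (j : ℕ∞) → ∀ X ∈ 𝒳, ExtZero X M j}

/-- `pd_𝒳(𝒴)` -/
def rpdClass (𝒳 𝒴 : Set (ModuleCat.{u} R)) : ℕ∞ := ⨆ Y : 𝒴, rpd 𝒳 Y

/-- `id_𝒳(𝒴)` -/
def ridClass (𝒳 𝒴 : Set (ModuleCat.{u} R)) : ℕ∞ := ⨆ Y : 𝒴, rid 𝒳 Y

/-- projective dimension -/
def pd (M : ModuleCat.{u} R) : ℕ∞ := rpd Set.univ M

/-- injective dimension -/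
def idim (M : ModuleCat.{u} R) : ℕ∞ := rid Set.univ M

/-- `pd(𝒴)` -/
def pdClass (𝒴 : Set (ModuleCat.{u} R)) : ℕ∞ := ⨆ Y : 𝒴, pd Y.1

/-- `id(𝒴)` -/
def idClass (𝒴 : Set (ModuleCat.{u} R)) : ℕ∞ := ⨆ Y : 𝒴, idim Y.1

/-- `M` has an `𝒳`-resolution `0 → X_n → ⋯ → X_0 → M → 0` of length `n`. -/
def HasResLen (𝒳 : Set (ModuleCat.{u} R)) : ℕ → ModuleCat.{u} R → Prop
  | 0, M => M ∈ 𝒳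
  | n+1, M => ∃ (K X : ModuleCat.{u} R) (f : K ⟶ X) (g : X ⟶ M),
      X ∈ 𝒳 ∧ IsSES f g ∧ HasResLen 𝒳 n K

/-- `M` has an `𝒳`-coresolution `0 → M → X_0 → ⋯ → X_n → 0` of length `n`. -/
def HasCoresLen (𝒳 : Set (ModuleCat.{u} R)) : ℕ → ModuleCat.{u} R → Prop
  | 0, M => M ∈ 𝒳
  | n+1, M => ∃ (X C : ModuleCat.{u} R) (f : M ⟶ X) (g : X ⟶ C),
      X ∈ 𝒳 ∧ IsSES f g ∧ HasCoresLen 𝒳 n C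

/-- `resdim_𝒳(M)` -/
def resdim (𝒳 : Set (ModuleCat.{u} R)) (M : ModuleCat.{u} R) : ℕ∞ :=
  ⨅ n : {n : ℕ // HasResLen 𝒳 n M}, (n : ℕ∞)

/-- `coresdim_𝒳(M)` -/
def coresdim (𝒳 : Set (ModuleCat.{u} R)) (M : ModuleCat.{u} R) : ℕ∞ :=
  ⨅ n : {n : ℕ // HasCoresLen 𝒳 n M}, (n : ℕ∞)

/-- `resdim_𝒳(𝒴)` -/
def resdimClass (𝒳 𝒴 : Set (ModuleCat.{u} R)) : ℕ∞ := ⨆ Y : 𝒴, resdim 𝒳 Y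

/-- `coresdim_𝒳(𝒴)` -/
def coresdimClass (𝒳 𝒴 : Set (ModuleCat.{u} R)) : ℕ∞ := ⨆ Y : 𝒴, coresdim 𝒳 Y

/-- `𝒳^∧`, the class of modules with a finite `𝒳`-resolution. -/
def resClosure (𝒳 : Set (ModuleCat.{u} R)) : Set (ModuleCat.{u} R) :=
  {M | ∃ n, HasResLen 𝒳 n M}

/-- `𝒳^∨`, the class of modules with a finite `𝒳`-coresolution. -/
def coresClosure (𝒳 : Set (ModuleCat.{u} R)) : Set (ModuleCat.{u} R) :=
  {M | ∃ n, HasCoresLen 𝒳 n M}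

/-- `(𝒜, ℬ)` is a cotorsion pair. -/
def IsCotorsionPair (𝒜 ℬ : Set (ModuleCat.{u} R)) : Prop :=
  (∀ M, M ∈ 𝒜 ↔ ∀ B ∈ ℬ, ExtZero M B 1) ∧
  (∀ M, M ∈ ℬ ↔ ∀ A ∈ 𝒜, ExtZero A M 1)

/-- completeness of a cotorsion pair -/
def IsComplete (𝒜 ℬ : Set (ModuleCat.{u} R)) : Prop :=
  ∀ M : ModuleCat.{u} R,
    (∃ (B A : ModuleCat.{u} R) (f : B ⟶ A) (g : A ⟶ M), B ∈ ℬ ∧ A ∈ 𝒜 ∧ IsSES f g) ∧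
    (∃ (B A : ModuleCat.{u} R) (f : M ⟶ B) (g : B ⟶ A), B ∈ ℬ ∧ A ∈ 𝒜 ∧ IsSES f g)

/-- heredity of a cotorsion pair -/
def IsHereditary (𝒜 ℬ : Set (ModuleCat.{u} R)) : Prop :=
  ∀ i : ℕ, 1 ≤ i → ∀ A ∈ 𝒜, ∀ B ∈ ℬ, ExtZero A B i

variable (R)

/-- `𝒫`, the class of modules of finite projective dimension. -/
def P : Set (ModuleCat.{u} R) := {M | pd M < ⊤}

variable {R}

/-- `M` admits a projective resolution consisting of finitely generated projectives,
i.e. `M ∈ mod R`. -/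
def InmodR (M : ModuleCat.{u} R) : Prop :=
  ∃ K : ℕ → ModuleCat.{u} R, K 0 = M ∧ ∀ i : ℕ,
    ∃ (Q : ModuleCat.{u} R) (f : K (i+1) ⟶ Q) (g : Q ⟶ K i),
      Module.Finite R Q ∧ Projective Q ∧ IsSES f g

variable (R)

/-- `𝒫^{<∞} = 𝒫 ∩ mod R`. -/
def Pfin : Set (ModuleCat.{u} R) := {M | pd M < ⊤ ∧ InmodR M}

/-- the big finitistic dimension -/
def bigFindim : ℕ∞ := pdClass (P R)

/-- the little finitistic dimension -/
def littleFindim : ℕ∞ := pdClass (Pfin R)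

variable {R}

/-- `𝒳^{⊥₁}` -/
def rperp1 (𝒳 : Set (ModuleCat.{u} R)) : Set (ModuleCat.{u} R) :=
  {M | ∀ X ∈ 𝒳, ExtZero X M 1}

/-- `^{⊥₁}𝒳` -/
def lperp1 (𝒳 : Set (ModuleCat.{u} R)) : Set (ModuleCat.{u} R) :=
  {M | ∀ X ∈ 𝒳, ExtZero M X 1}

/-- `T^⊥ = {M : Ext^i(T,M) = 0 for all i > 0}` -/
def rperpAll (T : ModuleCat.{u} R) : Set (ModuleCat.{u} R) :=
  {M | ∀ i : ℕ, 0 < i → ExtZero T M i}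

/-- `Add T`: direct summands of arbitrary direct sums of copies of `T`. -/
def AddT (T : ModuleCat.{u} R) : Set (ModuleCat.{u} R) :=
  {M | ∃ (I : Type u) (s : M ⟶ ModuleCat.of R (I →₀ T)) (r : ModuleCat.of R (I →₀ T) ⟶ M),
    s ≫ r = 𝟙 M}

/-- `T` is a tilting module. -/
def IsTilting (T : ModuleCat.{u} R) : Prop :=
  pd T < ⊤ ∧
  (∀ i : ℕ, 0 < i → ∀ I : Type u, ExtZero T (ModuleCat.of R (I →₀ T)) i) ∧
  ∃ n, HasCoresLen (AddT T) n (ModuleCat.of R R)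


/-- `𝒳` is closed under arbitrary direct sums (coproducts). -/
def ClosedUnderCoproducts (𝒳 : Set (ModuleCat.{u} R)) : Prop :=
  ∀ (I : Type u) (f : I → ModuleCat.{u} R), (∀ i, f i ∈ 𝒳) →
    ModuleCat.of R (⨁ i, (f i : Type u)) ∈ 𝒳

/-- `𝒳` is closed under direct summands. -/
def ClosedUnderSummands (𝒳 : Set (ModuleCat.{u} R)) : Prop :=
  ∀ (M N : ModuleCat.{u} R) (s : M ⟶ N) (r : N ⟶ M), s ≫ r = 𝟙 M → N ∈ 𝒳 → M ∈ 𝒳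

/-- The vanishing of `Ext` defined through left derived functors is the vanishing of
`Abelian.Ext`. -/
lemma extZero_succ_iff (M N : ModuleCat.{u} R) (n : ℕ) :
    ExtZero M N (n + 1) ↔ ∀ e : Abelian.Ext.{u} M N (n + 1), e = 0 := by
  let Q := ProjectiveResolution.of M
  have h : ExtZero M N (n + 1) ↔ ∀ f : Q.complex.X (n + 1) ⟶ N,
      Q.complex.d (n + 2) (n + 1) ≫ f = 0 →
        ∃ g : Q.complex.X n ⟶ N, Q.complex.d (n + 1) n ≫ g = f := by
    unfold ExtZero
    rw [(Q.isoExt (R := ℤ) (n + 1) N).isZero_iff,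
      ← HomologicalComplex.exactAt_iff_isZero_homology,
      HomologicalComplex.exactAt_iff' _ n (n + 1) (n + 2) (by simp) (by simp),
      ShortComplex.moduleCat_exact_iff]
    exact Iff.rfl
  rw [h]
  constructor
  · intro H e
    obtain ⟨f, hf, rfl⟩ := Q.extMk_surjective e (n + 2) rfl
    exact (Q.extMk_eq_zero_iff f _ rfl hf n rfl).2 (H f hf)
  · intro H f hf
    exact (Q.extMk_eq_zero_iff f _ rfl hf n rfl).1 (H _)

lemma extZero_of_rpd_lt {𝒳 : Set (ModuleCat.{u} R)} {M X : ModuleCat.{u} R} {j : ℕ}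
    (h : rpd 𝒳 M < j) (hX : X ∈ 𝒳) : ExtZero M X j := by
  obtain ⟨n, hn, hnj⟩ := sInf_lt_iff.1 h
  exact hn j hnj X hX

lemma pd_le_iff (M : ModuleCat.{u} R) (n : ℕ) :
    pd M ≤ n ↔ HasProjectiveDimensionLE M n := by
  rw [HasProjectiveDimensionLE, hasProjectiveDimensionLT_iff.{u}]
  constructor
  · rintro h (_ | i) hi Y
    · omega
    · exact (extZero_succ_iff M Y i).1 (extZero_of_rpd_lt
        (h.trans_lt (by exact_mod_cast hi)) (Set.mem_univ Y))
  · intro h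
    refine sInf_le ?_
    rintro (_ | j) hj Y -
    · exact absurd hj (by simp)
    · exact (extZero_succ_iff M Y j).2 fun e => h (j + 1) (by exact_mod_cast hj) e

lemma extZero_of_projective (M N : ModuleCat.{u} R) [Projective M] {i : ℕ} (hi : 1 ≤ i) :
    ExtZero M N i := by
  obtain ⟨i, rfl⟩ := Nat.exists_eq_add_of_le' hi
  exact isZero_Ext_succ_of_projective M N i

section LongExactSequence

variable {A B C : ModuleCat.{u} R} {f : A ⟶ B} {g : B ⟶ C}

lemma IsSES.extZero_left (h : IsSES f g) {N : ModuleCat.{u} R} {n : ℕ}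
    (hA : ExtZero A N (n + 1)) (hB : ExtZero B N (n + 2)) : ExtZero C N (n + 2) := by
  obtain ⟨w, hS⟩ := h
  refine (extZero_succ_iff C N (n + 1)).2 fun e => ?_
  obtain ⟨e', rfl⟩ := Abelian.Ext.contravariant_sequence_exact₃ hS N e
    ((extZero_succ_iff B N (n + 1)).1 hB _) (add_comm 1 (n + 1))
  simp [(extZero_succ_iff A N n).1 hA e']

lemma IsSES.extZero_right (h : IsSES f g) {M : ModuleCat.{u} R} {n : ℕ}
    (hB : ExtZero M B (n + 1)) (hA : ExtZero M A (n + 2)) : ExtZero M C (n + 1) := by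
  obtain ⟨w, hS⟩ := h
  refine (extZero_succ_iff M C n).2 fun e => ?_
  obtain ⟨e', rfl⟩ := Abelian.Ext.covariant_sequence_exact₃ M hS e rfl
    ((extZero_succ_iff M A (n + 1)).1 hA _)
  simp [(extZero_succ_iff M B n).1 hB e']

end LongExactSequence

/-- Dimension shifting along an `𝒳`-resolution. -/
lemma HasResLen.extZero {𝒳 : Set (ModuleCat.{u} R)} {N : ModuleCat.{u} R} {n : ℕ}
    (h𝒳 : ∀ X ∈ 𝒳, ∀ j, n < j → ExtZero X N j) :
    ∀ {m : ℕ} {M : ModuleCat.{u} R}, HasResLen 𝒳 m M → ∀ j, n + m < j → ExtZero M N j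
  | 0, M, hM, j, hj => h𝒳 M hM j hj
  | m + 1, _, ⟨_, X, _, _, hX, hses, hK⟩, j, hj => by
    obtain ⟨j, rfl⟩ := Nat.exists_eq_add_of_le' (show 2 ≤ j by omega)
    exact hses.extZero_left (hK.extZero h𝒳 (j + 1) (by omega)) (h𝒳 X hX _ (by omega))

lemma hasResLen_of_hasProjectiveDimensionLE {𝒳 : Set (ModuleCat.{u} R)}
    (h𝒳 : ∀ M : ModuleCat.{u} R, Projective M → M ∈ 𝒳) :
    ∀ (n : ℕ) (M : ModuleCat.{u} R), HasProjectiveDimensionLE M n → HasResLen 𝒳 n M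
  | 0, M, h => h𝒳 M ((projective_iff_hasProjectiveDimensionLE_zero M).2 h)
  | n + 1, M, h => by
    have hS : (ShortComplex.mk (kernel.ι (Projective.π M)) (Projective.π M)
        (kernel.condition _)).ShortExact :=
      { exact := ShortComplex.exact_kernel _ }
    exact ⟨_, _, _, _, h𝒳 _ inferInstance, ⟨_, hS⟩,
      hasResLen_of_hasProjectiveDimensionLE h𝒳 n _
        ((hS.hasProjectiveDimensionLT_X₃_iff n inferInstance).1 h)⟩

lemma resdim_le {𝒳 : Set (ModuleCat.{u} R)} {M : ModuleCat.{u} R} {n : ℕ}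
    (h : HasResLen 𝒳 n M) : resdim 𝒳 M ≤ n :=
  iInf_le (fun n : {n : ℕ // HasResLen 𝒳 n M} => ((n : ℕ) : ℕ∞)) ⟨n, h⟩

lemma exists_hasResLen_of_resdim_le {𝒳 : Set (ModuleCat.{u} R)} {M : ModuleCat.{u} R} {n : ℕ}
    (h : resdim 𝒳 M ≤ n) : ∃ m ≤ n, HasResLen 𝒳 m M := by
  obtain ⟨⟨m, hm⟩, hmn⟩ := iInf_lt_iff.1 (h.trans_lt (show (n : ℕ∞) < (n + 1 : ℕ) by
    exact_mod_cast n.lt_succ_self))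
  exact ⟨m, Nat.lt_succ_iff.1 (by exact_mod_cast hmn), hm⟩

lemma IsCotorsionPair.mem_left_of_projective {𝒜 ℬ : Set (ModuleCat.{u} R)}
    (h : IsCotorsionPair 𝒜 ℬ) (M : ModuleCat.{u} R) (_ : Projective M) : M ∈ 𝒜 :=
  (h.1 M).2 fun B _ => extZero_of_projective M B le_rfl

lemma resdimClass_P_lt_top {𝒳 : Set (ModuleCat.{u} R)}
    (h𝒳 : ∀ M : ModuleCat.{u} R, Projective M → M ∈ 𝒳) (h : bigFindim R < ⊤) :
    resdimClass 𝒳 (P R) < ⊤ := by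
  obtain ⟨n, hn⟩ := ENat.ne_top_iff_exists.1 h.ne
  refine (iSup_le fun M : P R => resdim_le (hasResLen_of_hasProjectiveDimensionLE h𝒳 n M.1 ?_)).trans_lt
    (ENat.natCast_lt_top n)
  exact (pd_le_iff _ _).1 ((le_iSup (fun Y : P R => pd Y.1) M).trans_eq hn.symm)

lemma bigFindim_lt_top {𝒜 ℬ : Set (ModuleCat.{u} R)} (hcomp : IsComplete 𝒜 ℬ)
    (hher : IsHereditary 𝒜 ℬ) (h𝒜 : rpdClass 𝒜 𝒜 < ⊤) (hres : resdimClass 𝒜 (P R) < ⊤) :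
    bigFindim R < ⊤ := by
  obtain ⟨n, hn⟩ := ENat.ne_top_iff_exists.1 h𝒜.ne
  obtain ⟨m, hm⟩ := ENat.ne_top_iff_exists.1 hres.ne
  refine (iSup_le fun M => sInf_le ?_).trans_lt (ENat.natCast_lt_top (n + m))
  intro j hj N _
  have hj' : n + m < j := by exact_mod_cast hj
  obtain ⟨k, hk, hM⟩ := exists_hasResLen_of_resdim_le
    ((le_iSup (fun Y : P R => resdim 𝒜 Y.1) M).trans_eq hm.symm)
  obtain ⟨⟨B, A, f, g, hB, hA, hses⟩, -⟩ := hcomp N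
  have hMA : ExtZero M.1 A j := hM.extZero (n := n) (fun X hX i hi =>
    extZero_of_rpd_lt (((le_iSup (fun Y : 𝒜 => rpd 𝒜 Y.1) ⟨X, hX⟩).trans_eq hn.symm).trans_lt
      (by exact_mod_cast hi)) hA) j (by omega)
  have hMB : ExtZero M.1 B (j + 1) :=
    hM.extZero (n := 0) (fun X hX i hi => hher i hi X hX B hB) (j + 1) (by omega)
  obtain ⟨j, rfl⟩ := Nat.exists_eq_add_of_le' (show 1 ≤ j by omega)
  exact hses.extZero_right hMA hMB

variable (R) in
lemma isCotorsionPair_projective_univ :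
    IsCotorsionPair {M : ModuleCat.{u} R | Projective M} Set.univ := by
  refine ⟨fun M => ⟨fun (_ : Projective M) B _ => extZero_of_projective M B le_rfl, fun h => ?_⟩,
    fun M => ⟨fun _ A (_ : Projective A) => extZero_of_projective A M le_rfl,
      fun _ => Set.mem_univ M⟩⟩
  refine projective_iff_subsingleton_ext_one.{u}.2 fun Y => ?_
  exact subsingleton_of_forall_eq 0 ((extZero_succ_iff M Y 0).1 (h Y (Set.mem_univ Y)))

open scoped ZeroObject in
variable (R) in
lemma isComplete_projective_univ :
    IsComplete {M : ModuleCat.{u} R | Projective M} Set.univ := by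
  refine fun M => ⟨⟨_, _, kernel.ι (Projective.π M), Projective.π M, Set.mem_univ _,
    inferInstanceAs (Projective (Projective.over M)), kernel.condition _,
    { exact := ShortComplex.exact_kernel _ }⟩, ?_⟩
  exact ⟨M, 0, 𝟙 M, 0, Set.mem_univ _, inferInstanceAs (Projective (0 : ModuleCat.{u} R)),
    comp_zero, { exact := (ShortComplex.exact_iff_epi _ rfl).2 inferInstance
                 mono_f := inferInstanceAs (Mono (𝟙 M))
                 epi_g := (isZero_zero _).epi _ }⟩

variable (R) in
lemma isHereditary_projective_univ :
    IsHereditary {M : ModuleCat.{u} R | Projective M} Set.univ :=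
  fun _ hi A (_ : Projective A) B _ => extZero_of_projective A B hi

variable (R) in
lemma rpdClass_projective_lt_top :
    rpdClass {M : ModuleCat.{u} R | Projective M} {M : ModuleCat.{u} R | Projective M} < ⊤ := by
  refine (iSup_le fun M => sInf_le ?_).trans_lt (ENat.natCast_lt_top 0)
  intro j hj X _
  have : Projective M.1 := M.2
  exact extZero_of_projective M.1 X (by exact_mod_cast hj)

/-- Corollary 4.3(I): criteria for finiteness of the big finitistic dimension. -/
theorem stmt2 {R : Type u} [Ring R] :
    (bigFindim R < ⊤ ↔
      ∃ 𝒜 ℬ : Set (ModuleCat.{u} R), IsCotorsionPair 𝒜 ℬ ∧ IsComplete 𝒜 ℬ ∧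
        IsHereditary 𝒜 ℬ ∧ rpdClass 𝒜 𝒜 < ⊤ ∧ resdimClass 𝒜 (P R) < ⊤) ∧
    (bigFindim R < ⊤ ↔
      ∀ 𝒜 ℬ : Set (ModuleCat.{u} R), IsCotorsionPair 𝒜 ℬ → IsComplete 𝒜 ℬ →
        IsHereditary 𝒜 ℬ → rpdClass 𝒜 𝒜 < ⊤ → resdimClass 𝒜 (P R) < ⊤) := by
  refine ⟨⟨fun h => ?_, fun ⟨𝒜, ℬ, _, hcomp, hher, h𝒜, hres⟩ =>
    bigFindim_lt_top hcomp hher h𝒜 hres⟩, fun h 𝒜 ℬ hcot _ _ _ =>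
      resdimClass_P_lt_top hcot.mem_left_of_projective h, fun h => ?_⟩
  · exact ⟨_, _, isCotorsionPair_projective_univ R, isComplete_projective_univ R,
      isHereditary_projective_univ R, rpdClass_projective_lt_top R,
      resdimClass_P_lt_top (isCotorsionPair_projective_univ R).mem_left_of_projective h⟩
  · exact bigFindim_lt_top (isComplete_projective_univ R) (isHereditary_projective_univ R)
      (rpdClass_projective_lt_top R) (h _ _ (isCotorsionPair_projective_univ R)
        (isComplete_projective_univ R) (isHereditary_projective_univ R)
        (rpdClass_projective_lt_top R))

end CotorsionDim
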